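/- arXiv:2503.21031 — 3 statements merged into one kernel-verified Lean document; each statement's English description precedes it below -/
import Mathlib

section
/- Let (Q,P) be a weakly quasi-lattice ordered group and let Λ be a P-graph. If (μ,δ) is a composable pair in Λ with μδ ∈ FA(Λ), then δ ∈ FA(Λ). In particular, FA(Λ) is closed under the source map (λ ∈ FA(Λ) implies s(λ) ∈ FA(Λ)), and if μ ∈ FA(Λ) then s(μ)Λ ⊆ FA(Λ). -/
set_option autoImplicit false

/-- The topology on the power set `Set α` obtained by identifying it with the
product `∏ _ : α, Prop` where each (two-point) factor `Prop` carries the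
discrete topology. -/
instance powersetTopology (α : Type) : TopologicalSpace (Set α) :=
  @Pi.topologicalSpace α (fun _ => Prop) (fun _ => ⊥)

/-- The cylinder `Z(K₁;K₂) = {x : K₁ ⊆ x ⊆ K₂ᶜ}`. -/
def cylinder {α : Type} (K₁ K₂ : Set α) : Set (Set α) :=
  {x | K₁ ⊆ x ∧ x ⊆ K₂ᶜ}

/-- The relation `p ≤ r` iff `p * q = r` for some `q ∈ P`. -/
def Submonoid.leftLE {Q : Type} [Group Q] (P : Submonoid Q) (p r : Q) : Prop :=
  ∃ q ∈ P, p * q = r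

/-- A weakly quasi-lattice ordered group `(Q,P)`: a group `Q` together with a
subsemigroup `P` containing the unit with `P ∩ P⁻¹ = {e}`, such that any two
elements of `P` with a common upper bound (for `leftLE`) have a least common
upper bound. -/
structure WQLO (Q : Type) [Group Q] where
  P : Submonoid Q
  inter_inv : ∀ p ∈ P, p⁻¹ ∈ P → p = 1
  lub : ∀ a ∈ P, ∀ b ∈ P, (∃ c ∈ P, P.leftLE a c ∧ P.leftLE b c) →
    ∃ l ∈ P, P.leftLE a l ∧ P.leftLE b l ∧
      ∀ c ∈ P, P.leftLE a c → P.leftLE b c → P.leftLE l c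

/-- A (discrete) `P`-graph: a countable small category, presented by its set of
morphisms `Λ` with range map `r`, source map `s` and a composition `mul`
(constrained by the axioms only on composable pairs, i.e. when `s μ = r ν`),
together with a degree functor `d : Λ → P` satisfying the unique factorisation
property. The units of `Λ` are exactly the elements of the form `r lam`. -/
structure PGraph (Q : Type) [Group Q] (W : WQLO Q) where
  Λ : Type
  countable : Countable Λ
  r : Λ → Λ
  s : Λ → Λ
  mul : Λ → Λ → Λ
  d : Λ → Q
  d_mem : ∀ lam, d lam ∈ W.P
  s_r : ∀ lam, s (r lam) = r lam
  r_r : ∀ lam, r (r lam) = r lam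
  s_s : ∀ lam, s (s lam) = s lam
  r_s : ∀ lam, r (s lam) = s lam
  id_mul : ∀ lam, mul (r lam) lam = lam
  mul_id : ∀ lam, mul lam (s lam) = lam
  r_mul : ∀ mu nu, s mu = r nu → r (mul mu nu) = r mu
  s_mul : ∀ mu nu, s mu = r nu → s (mul mu nu) = s nu
  mul_assoc : ∀ mu nu k, s mu = r nu → s nu = r k →
    mul (mul mu nu) k = mul mu (mul nu k)
  d_unit : ∀ lam, d (r lam) = 1
  d_mul : ∀ mu nu, s mu = r nu → d (mul mu nu) = d mu * d nu
  factor : ∀ lam, ∀ p ∈ W.P, ∀ q ∈ W.P, d lam = p * q →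
    ∃! mn : Λ × Λ, s mn.1 = r mn.2 ∧ mul mn.1 mn.2 = lam ∧ d mn.1 = p ∧ d mn.2 = q

namespace PGraph

variable {Q : Type} [Group Q] {W : WQLO Q} (G : PGraph Q W)

/-- `λΛ = {λμ : μ ∈ Λ, s λ = r μ}`. -/
def cone (lam : G.Λ) : Set G.Λ :=
  {x | ∃ mu, G.s lam = G.r mu ∧ x = G.mul lam mu}

/-- `λE = {λμ : μ ∈ E, s λ = r μ}`. -/
def coneSet (lam : G.Λ) (E : Set G.Λ) : Set G.Λ :=
  {x | ∃ mu ∈ E, G.s lam = G.r mu ∧ x = G.mul lam mu}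

/-- `Λ` is finitely aligned at the pair `(μ,ν)`. -/
def FinAlignedAtPair (mu nu : G.Λ) : Prop :=
  ∃ J : Finset G.Λ, G.cone mu ∩ G.cone nu = ⋃ lam ∈ (J : Set G.Λ), G.cone lam

/-- `Λ` is finitely aligned at `λ`. -/
def FinAlignedAt (lam : G.Λ) : Prop :=
  ∀ mu ∈ G.cone lam, ∀ nu : G.Λ, G.FinAlignedAtPair mu nu

/-- The finitely aligned part `FA(Λ)`. -/
def FA : Set G.Λ := {lam | G.FinAlignedAt lam}

/-- `FAr(Λ) = FA(Λ) ∪ r(FA(Λ))`. -/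
def FAr : Set G.Λ := G.FA ∪ G.r '' G.FA

/-- `μ ≼ λ` iff `μν = λ` for some `ν`. -/
def pre (mu lam : G.Λ) : Prop :=
  ∃ nu, G.s mu = G.r nu ∧ G.mul mu nu = lam

/-- A filter: a nonempty, hereditary and directed subset of `Λ`. -/
def IsFilter (x : Set G.Λ) : Prop :=
  x.Nonempty ∧ (∀ lam mu, G.pre lam mu → mu ∈ x → lam ∈ x) ∧
    ∀ mu ∈ x, ∀ nu ∈ x, ∃ lam ∈ x, G.pre mu lam ∧ G.pre nu lam

/-- The space `ℱΛ` of filters, with the subspace topology from `𝒫(Λ)`. -/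
abbrev FilterSpace := {x : Set G.Λ // G.IsFilter x}

/-- `Z_{ℱΛ}(μ;K) = {x ∈ ℱΛ : μ ∈ x ⊆ Λ∖K}`. -/
def Zf (mu : G.Λ) (K : Set G.Λ) : Set G.FilterSpace :=
  {x | mu ∈ x.1 ∧ x.1 ⊆ Kᶜ}

/-- An ultrafilter: a filter maximal with respect to inclusion. -/
def IsUltrafilter (x : Set G.Λ) : Prop :=
  G.IsFilter x ∧ ∀ y, G.IsFilter y → x ⊆ y → x = y

/-- The path space `PS(Λ)`: filters meeting `FA(Λ)` (as a set of subsets). -/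
def PS : Set (Set G.Λ) := {x | G.IsFilter x ∧ (x ∩ G.FA).Nonempty}

/-- The path space as a topological space (subspace of `𝒫(Λ)`). -/
abbrev PSpace := {x : Set G.Λ // x ∈ G.PS}

/-- The boundary-path space: the closure in `PS(Λ)` of the set of ultrafilters
lying in `PS(Λ)`. -/
def BPS : Set G.PSpace := closure {x : G.PSpace | G.IsUltrafilter x.1}

abbrev BPSpace := {x : G.PSpace // x ∈ G.BPS}

/-- The left shift `λ⁻¹·x = {μ : λμ ∈ x}`. -/
def lshift (lam : G.Λ) (x : Set G.Λ) : Set G.Λ :=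
  {mu | G.s lam = G.r mu ∧ G.mul lam mu ∈ x}

/-- The right shift `λ·x = {ζ : ζ ≼ λμ for some μ ∈ x}`. -/
def rshift (lam : G.Λ) (x : Set G.Λ) : Set G.Λ :=
  {z | ∃ mu ∈ x, G.s lam = G.r mu ∧ G.pre z (G.mul lam mu)}

/-- The action `x·m`: the left shift of `x` by the unique element of
`x ∩ Λ^m` (when it exists). -/
def act (x : Set G.Λ) (m : Q) : Set G.Λ :=
  ⋃ lam ∈ {l ∈ x | G.d l = m}, G.lshift lam x

/-- The domain `D_m = {x ∈ PS(Λ) : x ∩ Λ^m ≠ ∅}` of `T_m`. -/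
def Dom (m : Q) : Set (Set G.Λ) := {x ∈ G.PS | ∃ l ∈ x, G.d l = m}

/-- The range `R_m = {x·m : x ∈ D_m}` of `T_m`. -/
def Ran (m : Q) : Set (Set G.Λ) := {y | ∃ x ∈ G.Dom m, G.act x m = y}

end PGraph

namespace PGraph

variable {Q : Type} [Group Q] {W : WQLO Q} (G : PGraph Q W)

/-- Left cancellation in a `P`-graph. -/
theorem mul_left_cancel_of_composable {mu a b : G.Λ} (ha : G.s mu = G.r a)
    (hb : G.s mu = G.r b) (h : G.mul mu a = G.mul mu b) : a = b := by
  have hd : G.d a = G.d b := by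
    have h' := congrArg G.d h
    rw [G.d_mul _ _ ha, G.d_mul _ _ hb] at h'
    exact mul_left_cancel h'
  have hu := (G.factor (G.mul mu a) (G.d mu) (G.d_mem mu) (G.d a) (G.d_mem a)
    (G.d_mul _ _ ha)).unique (y₁ := (mu, a)) (y₂ := (mu, b))
    ⟨ha, rfl, rfl, rfl⟩ ⟨hb, h.symm, rfl, hd.symm⟩
  exact congrArg Prod.snd hu

theorem mem_cone_self (lam : G.Λ) : lam ∈ G.cone lam :=
  ⟨G.s lam, (G.r_s lam).symm, (G.mul_id lam).symm⟩

theorem r_eq_of_mem_cone {lam x : G.Λ} (h : x ∈ G.cone lam) : G.r x = G.r lam := by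
  obtain ⟨k, hk, rfl⟩ := h
  exact G.r_mul _ _ hk

theorem mul_mem_cone_mul {mu a x : G.Λ} (ha : G.s mu = G.r a) (hx : x ∈ G.cone a) :
    G.mul mu x ∈ G.cone (G.mul mu a) := by
  obtain ⟨k, hk, rfl⟩ := hx
  exact ⟨k, (G.s_mul _ _ ha).trans hk, (G.mul_assoc _ _ _ ha hk).symm⟩

theorem exists_of_mem_cone_mul {mu a y : G.Λ} (ha : G.s mu = G.r a)
    (hy : y ∈ G.cone (G.mul mu a)) : ∃ x ∈ G.cone a, y = G.mul mu x := by
  obtain ⟨k, hk, rfl⟩ := hy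
  rw [G.s_mul _ _ ha] at hk
  exact ⟨G.mul a k, ⟨k, hk, rfl⟩, G.mul_assoc _ _ _ ha hk⟩

theorem mul_mem_cone_mul_iff {mu a x : G.Λ} (ha : G.s mu = G.r a) (hx : G.s mu = G.r x) :
    G.mul mu x ∈ G.cone (G.mul mu a) ↔ x ∈ G.cone a := by
  refine ⟨fun h => ?_, G.mul_mem_cone_mul ha⟩
  obtain ⟨z, hz, hxz⟩ := G.exists_of_mem_cone_mul ha h
  have hz' : G.s mu = G.r z := ha.trans (G.r_eq_of_mem_cone hz).symm
  rwa [G.mul_left_cancel_of_composable hx hz' hxz]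

theorem cone_subset_cone {lam mu : G.Λ} (h : mu ∈ G.cone lam) : G.cone mu ⊆ G.cone lam := by
  obtain ⟨k, hk, rfl⟩ := h
  intro y hy
  obtain ⟨x, hx, rfl⟩ := G.exists_of_mem_cone_mul hk hy
  exact ⟨x, hk.trans (G.r_eq_of_mem_cone hx).symm, rfl⟩

theorem cone_subset_FA {lam : G.Λ} (h : lam ∈ G.FA) : G.cone lam ⊆ G.FA :=
  fun _ hx mu hmu nu => h mu (G.cone_subset_cone hx hmu) nu

/-- Finite alignment at a pair is inherited after cancelling a common initial segment. -/
theorem FinAlignedAtPair.of_mul {mu a b : G.Λ} (ha : G.s mu = G.r a) (hb : G.s mu = G.r b)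
    (h : G.FinAlignedAtPair (G.mul mu a) (G.mul mu b)) : G.FinAlignedAtPair a b := by
  obtain ⟨J, hJ⟩ := h
  have hfin : {k | G.s mu = G.r k ∧ G.mul mu k ∈ J}.Finite :=
    Set.Finite.of_injOn (f := G.mul mu) (t := (J : Set G.Λ)) (fun _ hk => hk.2)
      (fun _ hk _ hl => G.mul_left_cancel_of_composable hk.1 hl.1) J.finite_toSet
  refine ⟨hfin.toFinset, ?_⟩
  rw [Set.Finite.coe_toFinset]
  ext x
  simp only [Set.mem_iUnion, Set.mem_ofPred_eq, exists_prop]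
  constructor
  · rintro ⟨hxa, hxb⟩
    have hx : G.s mu = G.r x := ha.trans (G.r_eq_of_mem_cone hxa).symm
    have hmem : G.mul mu x ∈ ⋃ lam ∈ (J : Set G.Λ), G.cone lam :=
      hJ ▸ ⟨G.mul_mem_cone_mul ha hxa, G.mul_mem_cone_mul hb hxb⟩
    simp only [Set.mem_iUnion, exists_prop] at hmem
    obtain ⟨j, hj, hxj⟩ := hmem
    have hja : j ∈ G.cone (G.mul mu a) ∩ G.cone (G.mul mu b) :=
      hJ ▸ Set.mem_biUnion hj (G.mem_cone_self j)
    obtain ⟨k, hk, rfl⟩ := G.exists_of_mem_cone_mul ha hja.1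
    have hk' : G.s mu = G.r k := ha.trans (G.r_eq_of_mem_cone hk).symm
    exact ⟨k, ⟨hk', hj⟩, (G.mul_mem_cone_mul_iff hk' hx).1 hxj⟩
  · rintro ⟨k, ⟨hk, hkJ⟩, hxk⟩
    have hx : G.s mu = G.r x := hk.trans (G.r_eq_of_mem_cone hxk).symm
    have hmem : G.mul mu x ∈ G.cone (G.mul mu a) ∩ G.cone (G.mul mu b) :=
      hJ ▸ Set.mem_biUnion (Finset.mem_coe.2 hkJ) (G.mul_mem_cone_mul hk hxk)
    exact ⟨(G.mul_mem_cone_mul_iff ha hx).1 hmem.1, (G.mul_mem_cone_mul_iff hb hx).1 hmem.2⟩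

theorem finAlignedAtPair_of_r_ne {a b : G.Λ} (h : G.r a ≠ G.r b) : G.FinAlignedAtPair a b := by
  refine ⟨∅, ?_⟩
  ext x
  simp only [Finset.coe_empty, Set.mem_empty_iff_false, Set.iUnion_of_empty, Set.iUnion_empty,
    iff_false]
  rintro ⟨hxa, hxb⟩
  exact h ((G.r_eq_of_mem_cone hxa).symm.trans (G.r_eq_of_mem_cone hxb))

theorem mem_FA_of_mul_mem_FA {mu delta : G.Λ} (h : G.s mu = G.r delta)
    (hFA : G.mul mu delta ∈ G.FA) : delta ∈ G.FA := by
  intro a ha b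
  by_cases hab : G.r a = G.r b
  · have hmu : G.s mu = G.r a := h.trans (G.r_eq_of_mem_cone ha).symm
    exact FinAlignedAtPair.of_mul G hmu (hmu.trans hab)
      (hFA _ (G.mul_mem_cone_mul h ha) _)
  · exact G.finAlignedAtPair_of_r_ne hab

end PGraph

/-- If `(μ,δ)` is composable and `μδ ∈ FA(Λ)` then `δ ∈ FA(Λ)`; in particular
`FA(Λ)` is closed under the source map, and `μ ∈ FA(Λ)` implies
`s(μ)Λ ⊆ FA(Λ)`. -/
theorem statement2 {Q : Type} [Group Q] {W : WQLO Q} (G : PGraph Q W) :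
    (∀ mu delta : G.Λ, G.s mu = G.r delta → G.mul mu delta ∈ G.FA → delta ∈ G.FA) ∧
    (∀ lam ∈ G.FA, G.s lam ∈ G.FA) ∧
    (∀ mu ∈ G.FA, G.cone (G.s mu) ⊆ G.FA) := by
  have hs : ∀ lam ∈ G.FA, G.s lam ∈ G.FA := fun lam hlam =>
    G.mem_FA_of_mul_mem_FA (G.r_s lam).symm ((G.mul_id lam).symm ▸ hlam)
  exact ⟨fun _ _ => G.mem_FA_of_mul_mem_FA, hs, fun mu hmu => G.cone_subset_FA (hs mu hmu)⟩
end

section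
/- Let (Q,P) be a weakly quasi-lattice ordered group and let Λ be a P-graph. For any λ ∈ Λ, the following are equivalent: (1) λ ∈ FA(Λ); (2) the cylinder Z_{ℱΛ}(λ) = {x ∈ ℱΛ : λ ∈ x} is a compact subset of the space ℱΛ of filters. -/
set_option autoImplicit false

/-- Membership of a fixed point is a clopen condition on the power set. -/
theorem isClopen_setOf_mem {α : Type} (a : α) : IsClopen {x : Set α | a ∈ x} := by
  let : TopologicalSpace Prop := ⊥
  have : DiscreteTopology Prop := ⟨rfl⟩
  have h : @Continuous (∀ _ : α, Prop) Prop (@Pi.topologicalSpace α (fun _ => Prop) fun _ => ⊥) ⊥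
      (fun x => x a) := continuous_apply a
  exact (isClopen_discrete {p : Prop | p}).preimage h

/-- The power set is compact. -/
theorem compactSpace_powerset (α : Type) : CompactSpace (Set α) := by
  let : TopologicalSpace Prop := ⊥
  exact @Pi.compactSpace α (fun _ => Prop) (fun _ => ⊥) (fun _ => Finite.compactSpace)

theorem isClosed_setOf_mem_imp {α : Type} (a : α) {p : Set α → Prop}
    (hp : IsClosed {x | p x}) : IsClosed {x : Set α | a ∈ x → p x} :=
  isClosed_imp (isClopen_setOf_mem a).isOpen hp

namespace PGraph

variable {Q : Type} [Group Q] {W : WQLO Q} (G : PGraph Q W)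

theorem mem_cone_iff_pre {lam mu : G.Λ} : mu ∈ G.cone lam ↔ G.pre lam mu :=
  ⟨fun ⟨k, h, e⟩ => ⟨k, h, e.symm⟩, fun ⟨k, h, e⟩ => ⟨k, h, e.symm⟩⟩

theorem pre_refl (lam : G.Λ) : G.pre lam lam :=
  ⟨G.s lam, (G.r_s lam).symm, G.mul_id lam⟩

theorem pre_trans {lam mu nu : G.Λ} (h₁ : G.pre lam mu) (h₂ : G.pre mu nu) : G.pre lam nu := by
  obtain ⟨a, ha, rfl⟩ := h₁
  obtain ⟨b, hb, rfl⟩ := h₂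
  have hab : G.s a = G.r b := by rw [← G.s_mul lam a ha, hb]
  exact ⟨G.mul a b, by rw [G.r_mul a b hab, ha], (G.mul_assoc lam a b ha hab).symm⟩

theorem isFilter_setOf_pre (lam : G.Λ) : G.IsFilter {z | G.pre z lam} :=
  ⟨⟨lam, G.pre_refl lam⟩, fun _ _ h h' => G.pre_trans h h',
    fun _ hmu _ hnu => ⟨lam, G.pre_refl lam, hmu, hnu⟩⟩

/-- Finite alignment at a pair, in terms of the preorder `≼`. -/
theorem finAlignedAtPair_iff {mu nu : G.Λ} :
    G.FinAlignedAtPair mu nu ↔ ∃ J : Finset G.Λ, (∀ k ∈ J, G.pre mu k ∧ G.pre nu k) ∧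
      ∀ k, G.pre mu k → G.pre nu k → ∃ j ∈ J, G.pre j k := by
  refine exists_congr fun J => ?_
  simp only [Set.ext_iff, Set.mem_inter_iff, Set.mem_iUnion, mem_cone_iff_pre, Finset.mem_coe,
    exists_prop]
  constructor
  · intro h
    exact ⟨fun k hk => (h k).2 ⟨k, hk, G.pre_refl k⟩, fun k h₁ h₂ => (h k).1 ⟨h₁, h₂⟩⟩
  · rintro ⟨hJ, h⟩ k
    refine ⟨fun hk => h k hk.1 hk.2, ?_⟩
    rintro ⟨j, hj, hjk⟩
    exact ⟨G.pre_trans (hJ j hj).1 hjk, G.pre_trans (hJ j hj).2 hjk⟩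

/-- At a finitely aligned `lam`, the filters containing `lam` form a closed subset of the
power set. -/
theorem isClosed_setOf_isFilter_and_mem {lam : G.Λ} (h : lam ∈ G.FA) :
    IsClosed {x : Set G.Λ | G.IsFilter x ∧ lam ∈ x} := by
  have hJ : ∀ mu, G.pre lam mu → ∀ nu, ∃ J : Finset G.Λ,
      (∀ k ∈ J, G.pre mu k ∧ G.pre nu k) ∧
        ∀ k, G.pre mu k → G.pre nu k → ∃ j ∈ J, G.pre j k := fun mu hmu nu =>
    G.finAlignedAtPair_iff.1 (h mu (G.mem_cone_iff_pre.2 hmu) nu)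
  choose J hJ₁ hJ₂ using hJ
  have key : {x : Set G.Λ | G.IsFilter x ∧ lam ∈ x} =
      {x | lam ∈ x} ∩ ((⋂ (a) (b) (_ : G.pre a b), {x | b ∈ x → a ∈ x}) ∩
        ⋂ (mu) (hmu : G.pre lam mu) (nu), {x | mu ∈ x → nu ∈ x →
          x ∈ ⋃ j ∈ J mu hmu nu, {y : Set G.Λ | j ∈ y}}) := by
    ext x
    simp only [Set.mem_inter_iff, Set.mem_iInter, Set.mem_ofPred_eq, Set.mem_iUnion, exists_prop]
    constructor
    · rintro ⟨⟨-, hher, hdir⟩, hlam⟩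
      refine ⟨hlam, hher, fun mu hmu nu hmx hnx => ?_⟩
      obtain ⟨k, hk, h₁, h₂⟩ := hdir mu hmx nu hnx
      obtain ⟨j, hj, hjk⟩ := hJ₂ mu hmu nu k h₁ h₂
      exact ⟨j, hj, hher j k hjk hk⟩
    · rintro ⟨hlam, hher, hdir⟩
      refine ⟨⟨⟨lam, hlam⟩, hher, fun mu hmu nu hnu => ?_⟩, hlam⟩
      obtain ⟨k, hk, hkx⟩ := hdir lam (G.pre_refl lam) mu hlam hmu
      obtain ⟨hk₁, hk₂⟩ := hJ₁ _ _ _ k hk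
      obtain ⟨l, hl, hlx⟩ := hdir k hk₁ nu hkx hnu
      obtain ⟨hl₁, hl₂⟩ := hJ₁ _ _ _ l hl
      exact ⟨l, hlx, G.pre_trans hk₂ hl₁, hl₂⟩
  rw [key]
  refine (isClopen_setOf_mem lam).isClosed.inter (IsClosed.inter ?_ ?_)
  · exact isClosed_iInter fun a => isClosed_iInter fun b => isClosed_iInter fun _ =>
      isClosed_setOf_mem_imp b (isClopen_setOf_mem a).isClosed
  · refine isClosed_iInter fun mu => isClosed_iInter fun hmu => isClosed_iInter fun nu =>
      isClosed_setOf_mem_imp mu (isClosed_setOf_mem_imp nu ?_)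
    exact (J mu hmu nu).finite_toSet.isClosed_biUnion fun j _ => (isClopen_setOf_mem j).isClosed

theorem isClopen_setOf_mem_filterSpace (lam : G.Λ) :
    IsClopen {x : G.FilterSpace | lam ∈ x.1} :=
  (isClopen_setOf_mem lam).preimage continuous_subtype_val

theorem isCompact_cylinder_of_mem_FA {lam : G.Λ} (h : lam ∈ G.FA) :
    IsCompact {x : G.FilterSpace | lam ∈ x.1} := by
  have := compactSpace_powerset G.Λ
  rw [Subtype.isCompact_iff]
  convert (G.isClosed_setOf_isFilter_and_mem h).isCompact using 1
  ext x
  simp [and_comm]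

theorem mem_FA_of_isCompact_cylinder {lam : G.Λ}
    (h : IsCompact {x : G.FilterSpace | lam ∈ x.1}) : lam ∈ G.FA := by
  intro mu hmu nu
  rw [mem_cone_iff_pre] at hmu
  rw [finAlignedAtPair_iff]
  have hc : IsCompact ({x : G.FilterSpace | mu ∈ x.1} ∩ {x : G.FilterSpace | nu ∈ x.1}) :=
    h.of_isClosed_subset ((G.isClopen_setOf_mem_filterSpace mu).isClosed.inter
      (G.isClopen_setOf_mem_filterSpace nu).isClosed) fun x hx => x.2.2.1 lam mu hmu hx.1
  obtain ⟨b, hb, hfin, hcov⟩ := hc.elim_finite_subcover_image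
    (b := {k | G.pre mu k ∧ G.pre nu k}) (c := fun k => {x : G.FilterSpace | k ∈ x.1})
    (fun k _ => (G.isClopen_setOf_mem_filterSpace k).isOpen) (fun x hx => by
      obtain ⟨k, hk, h₁, h₂⟩ := x.2.2.2 mu hx.1 nu hx.2
      exact Set.mem_biUnion (show k ∈ {k | G.pre mu k ∧ G.pre nu k} from ⟨h₁, h₂⟩) hk)
  refine ⟨hfin.toFinset, fun k hk => hb (hfin.mem_toFinset.1 hk), fun k h₁ h₂ => ?_⟩
  obtain ⟨j, hj, hjk⟩ := Set.mem_iUnion₂.1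
    (@hcov ⟨{z | G.pre z k}, G.isFilter_setOf_pre k⟩ ⟨h₁, h₂⟩)
  exact ⟨j, hfin.mem_toFinset.2 hj, hjk⟩

end PGraph

/-- `λ ∈ FA(Λ)` iff the cylinder `Z_{ℱΛ}(λ)` is a compact subset of `ℱΛ`. -/
theorem statement7 {Q : Type} [Group Q] {W : WQLO Q} (G : PGraph Q W)
    (lam : G.Λ) :
    lam ∈ G.FA ↔ IsCompact {x : G.FilterSpace | lam ∈ x.1} :=
  ⟨G.isCompact_cylinder_of_mem_FA, G.mem_FA_of_isCompact_cylinder⟩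
end

section
/- Let (Q,P) be a weakly quasi-lattice ordered group and let Λ be a P-graph with FA(Λ) ≠ ∅. Then the semigroup action (PS(Λ),P,T) is directed: for all m,n ∈ P, if D_m ∩ D_n ≠ ∅ then there is l ∈ P with m ≤ l, n ≤ l and D_m ∩ D_n ⊆ D_l. -/
set_option autoImplicit false

namespace PGraph

variable {Q : Type} [Group Q] {W : WQLO Q} (G : PGraph Q W)

/-- The degree map is monotone. -/
theorem leftLE_d_of_pre {mu lam : G.Λ} (h : G.pre mu lam) : W.P.leftLE (G.d mu) (G.d lam) := by
  obtain ⟨nu, hs, rfl⟩ := h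
  exact ⟨G.d nu, G.d_mem nu, (G.d_mul mu nu hs).symm⟩

/-- Every degree below the degree of a path is attained by an initial segment of it. -/
theorem exists_pre_of_leftLE_d {lam : G.Λ} {p : Q} (hp : p ∈ W.P) (h : W.P.leftLE p (G.d lam)) :
    ∃ mu, G.pre mu lam ∧ G.d mu = p := by
  obtain ⟨q, hq, hpq⟩ := h
  obtain ⟨⟨mu, nu⟩, ⟨hs, hmul, hd, -⟩, -⟩ := G.factor lam p hp q hq hpq.symm
  exact ⟨mu, ⟨nu, hs, hmul⟩, hd⟩

/-- A filter in `D_m ∩ D_n` contains an element whose degree is above both `m` and `n`. -/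
theorem exists_leftLE_d_of_mem_Dom {m n : Q} {x : Set G.Λ} (hx : x ∈ G.Dom m ∩ G.Dom n) :
    ∃ lam ∈ x, W.P.leftLE m (G.d lam) ∧ W.P.leftLE n (G.d lam) := by
  obtain ⟨⟨⟨⟨-, -, hdir⟩, -⟩, mu, hmu, rfl⟩, -, nu, hnu, rfl⟩ := hx
  obtain ⟨lam, hlam, h₁, h₂⟩ := hdir mu hmu nu hnu
  exact ⟨lam, hlam, G.leftLE_d_of_pre h₁, G.leftLE_d_of_pre h₂⟩

end PGraph

/-- The semigroup action `(PS(Λ), P, T)` is directed: if `D_m ∩ D_n ≠ ∅` then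
there is `l ∈ P` with `m ≤ l`, `n ≤ l` and `D_m ∩ D_n ⊆ D_l`. -/
theorem statement13 {Q : Type} [Group Q] {W : WQLO Q} (G : PGraph Q W)
    (hne : G.FA.Nonempty) (m n : Q) (hm : m ∈ W.P) (hn : n ∈ W.P)
    (h : (G.Dom m ∩ G.Dom n).Nonempty) :
    ∃ l ∈ W.P, W.P.leftLE m l ∧ W.P.leftLE n l ∧ G.Dom m ∩ G.Dom n ⊆ G.Dom l := by
  obtain ⟨x, hx⟩ := h
  obtain ⟨c, -, hmc, hnc⟩ := G.exists_leftLE_d_of_mem_Dom hx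
  obtain ⟨l, hl, hml, hnl, hleast⟩ := W.lub m hm n hn ⟨G.d c, G.d_mem c, hmc, hnc⟩
  refine ⟨l, hl, hml, hnl, fun y hy => ⟨hy.1.1, ?_⟩⟩
  obtain ⟨lam, hlam, h₁, h₂⟩ := G.exists_leftLE_d_of_mem_Dom hy
  obtain ⟨mu, hpre, hd⟩ := G.exists_pre_of_leftLE_d hl (hleast _ (G.d_mem lam) h₁ h₂)
  exact ⟨mu, hy.1.1.1.2.1 mu lam hpre hlam, hd⟩
end
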